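/- arXiv:2107.02835 — 8 statements merged into one kernel-verified Lean document; each statement's English description precedes it below -/
import Mathlib

section
/- Fix an integer n ≥ 2, positive revision rates λ_1,…,λ_n, a positive normalization constant τ̄, and sign-preserving Lipschitz functions φ_1,…,φ_n defining an RM-PC protocol. Then for every x in the simplex X and every p ∈ ℝ^n, the RM-PC mean dynamics vanish at (x,p), i.e. V(x,p) = 0, if and only if x is a best response to p, i.e. xᵀp = max_{y ∈ X} yᵀp. (Nash stationarity of RM-PC protocols.) -/
open scoped BigOperators
open Finset

noncomputable section

namespace RMPC

/-- The probability simplex in `ℝ^n`. -/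
def simplex (n : ℕ) : Set (Fin n → ℝ) :=
  {x | (∀ i, 0 ≤ x i) ∧ ∑ i, x i = 1}

/-- A function `φ : ℝ → ℝ` is sign-preserving if it is positive on positive
arguments and vanishes on nonpositive ones (hence takes values in `ℝ_{≥0}`). -/
def SignPreserving (φ : ℝ → ℝ) : Prop :=
  (∀ s : ℝ, 0 < s → 0 < φ s) ∧ (∀ s : ℝ, s ≤ 0 → φ s = 0)

/-- The RM-PC mean dynamics
`V_i(x,p) = Σ_{j≠i} λ_j (1/τ̄) φ_i(p_i − p_j) x_j − Σ_{j≠i} λ_i (1/τ̄) φ_j(p_j − p_i) x_i`. -/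
def Vdyn (n : ℕ) (lam : Fin n → ℝ) (τ : ℝ) (φ : Fin n → ℝ → ℝ)
    (x p : Fin n → ℝ) (i : Fin n) : ℝ :=
  (∑ j ∈ Finset.univ.erase i, lam j * (1 / τ) * φ i (p i - p j) * x j)
    - ∑ j ∈ Finset.univ.erase i, lam i * (1 / τ) * φ j (p j - p i) * x i

/-- `ψ(s) = ∫_0^s φ(r) dr`. -/
def psiF (φ : ℝ → ℝ) (s : ℝ) : ℝ := ∫ r in (0:ℝ)..s, φ r

/-- `γ_i(p) = Σ_k ψ_k(p_k − p_i)`. -/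
def gammaF (n : ℕ) (φ : Fin n → ℝ → ℝ) (i : Fin n) (p : Fin n → ℝ) : ℝ :=
  ∑ k, psiF (φ k) (p k - p i)

/-- Worst-case revision rate ratio `λ_R = max { λ_i / λ_j }`. -/
def lamR (n : ℕ) (lam : Fin n → ℝ) : ℝ :=
  ⨆ ij : Fin n × Fin n, lam ij.1 / lam ij.2

/-- The set of values `γ_k(p) Σ_i φ_i(p_i − p_k) / Σ_i φ_i(p_i − p_k) γ_i(p)`,
over `p` with nonvanishing denominator. -/
def thresholdSet (n : ℕ) (φ : Fin n → ℝ → ℝ) (k : Fin n) : Set ℝ :=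
  {c | ∃ p : Fin n → ℝ,
    (∑ i, φ i (p i - p k) * gammaF n φ i p) ≠ 0 ∧
    c = (gammaF n φ k p * ∑ i, φ i (p i - p k)) /
        (∑ i, φ i (p i - p k) * gammaF n φ i p)}

/-- The threshold `λ̄_φ(n)`. -/
def lamBar (n : ℕ) (φ : Fin n → ℝ → ℝ) : ℝ :=
  ⨅ k : Fin n, sInf (thresholdSet n φ k)

/-- The δ-storage function `S(x,p) = (1/τ̄) Σ_i λ_i x_i γ_i(p)`. -/
def Sfun (n : ℕ) (lam : Fin n → ℝ) (τ : ℝ) (φ : Fin n → ℝ → ℝ)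
    (x p : Fin n → ℝ) : ℝ :=
  (1 / τ) * ∑ i, lam i * x i * gammaF n φ i p

/-- The dissipation rate `𝔖(x,p) = −(1/τ̄) Σ_i λ_i V_i(x,p) γ_i(p)`. -/
def SigFun (n : ℕ) (lam : Fin n → ℝ) (τ : ℝ) (φ : Fin n → ℝ → ℝ)
    (x p : Fin n → ℝ) : ℝ :=
  -((1 / τ) * ∑ i, lam i * Vdyn n lam τ φ x p i * gammaF n φ i p)

/-- **Nash stationarity of RM-PC protocols.** For an RM-PC protocol with positive
revision rates, the mean dynamics vanish at `(x,p)` iff `x` is a best response to `p`. -/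
theorem rmpc_nash_stationarity (n : ℕ) (hn : 2 ≤ n)
    (lam : Fin n → ℝ) (hlam : ∀ i, 0 < lam i)
    (τ : ℝ) (hτ : 0 < τ)
    (φ : Fin n → ℝ → ℝ)
    (hφ : ∀ j, SignPreserving (φ j))
    (hLip : ∀ j, ∃ K, LipschitzWith K (φ j)) :
    ∀ x ∈ simplex n, ∀ p : Fin n → ℝ,
      ((∀ i, Vdyn n lam τ φ x p i = 0) ↔
        (∀ y ∈ simplex n, (∑ i, y i * p i) ≤ ∑ i, x i * p i)) := by
  intro x hx p
  obtain ⟨hx0, hx1⟩ := hx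
  have hne : Nonempty (Fin n) := ⟨⟨0, by omega⟩⟩
  obtain ⟨m, hm⟩ := Finite.exists_max p
  have hnn : ∀ j s, 0 ≤ φ j s := by
    intro j s
    rcases le_or_gt s 0 with h | h
    · exact ((hφ j).2 s h).ge
    · exact ((hφ j).1 s h).le
  constructor
  · intro hV y hy
    have h := hV m
    unfold Vdyn at h
    have h2 : ∑ j ∈ Finset.univ.erase m, lam m * (1 / τ) * φ j (p j - p m) * x m = 0 := by
      apply Finset.sum_eq_zero
      intro j _
      rw [(hφ j).2 _ (sub_nonpos.mpr (hm j))]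
      ring
    rw [h2, sub_zero, Finset.sum_eq_zero_iff_of_nonneg] at h
    · have key : ∀ j, x j * p j = x j * p m := by
        intro j
        by_cases hj : p j = p m
        · rw [hj]
        · have hlt : p j < p m := lt_of_le_of_ne (hm j) hj
          have hjm : j ≠ m := fun e => hj (by rw [e])
          have h3 := h j (by simp [hjm])
          have h4 := (hφ m).1 _ (sub_pos.mpr hlt)
          have h5 : 0 < lam j * (1 / τ) * φ m (p m - p j) :=
            mul_pos (mul_pos (hlam j) (one_div_pos.mpr hτ)) h4
          have h6 : x j = 0 := (mul_eq_zero.mp h3).resolve_left h5.ne'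
          simp [h6]
      simp_rw [key]
      rw [← Finset.sum_mul, hx1, ← hy.2, Finset.sum_mul]
      exact Finset.sum_le_sum fun i _ => mul_le_mul_of_nonneg_left (hm i) (hy.1 i)
    · intro j _
      exact mul_nonneg (mul_nonneg (mul_pos (hlam j) (one_div_pos.mpr hτ)).le (hnn _ _)) (hx0 j)
  · intro hB i
    have h1 := hB (Pi.single m 1) ⟨fun i => by
      by_cases h : i = m
      · subst h; simp
      · simp [h], by simp⟩
    simp [Pi.single_apply] at h1
    have h2 : ∑ j, x j * (p m - p j) ≤ 0 := by
      simp_rw [mul_sub]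
      rw [Finset.sum_sub_distrib, ← Finset.sum_mul, hx1]
      linarith
    have h0 : ∀ j ∈ Finset.univ, 0 ≤ x j * (p m - p j) :=
      fun j _ => mul_nonneg (hx0 j) (sub_nonneg.mpr (hm j))
    have h3 := (Finset.sum_eq_zero_iff_of_nonneg h0).mp (le_antisymm h2 (Finset.sum_nonneg h0))
    have key : ∀ k j, φ k (p k - p j) * x j = 0 := by
      intro k j
      rcases mul_eq_zero.mp (h3 j (Finset.mem_univ j)) with h | h
      · rw [h, mul_zero]
      · rw [(hφ k).2 _ (by linarith [hm k]), zero_mul]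
    unfold Vdyn
    simp [mul_assoc, key]

end RMPC
end
end

section
/- Fix an integer n ≥ 2, positive revision rates λ_1,…,λ_n, a positive normalization constant τ̄, and sign-preserving Lipschitz functions φ_1,…,φ_n defining an RM-PC protocol. Suppose either (i) n = 2, or (ii) n ≥ 3 and the worst-case revision rate ratio satisfies λ_R < λ̄_φ(n). Then the RM-PC protocol is δ-passive: there exist functions S : X × ℝ^n → ℝ_{≥0} and 𝔖 : X × ℝ^n → ℝ_{≥0} such that for all x ∈ X and all p, u ∈ ℝ^n: (a) (∂S/∂x)(x,p)·V(x,p) + (∂S/∂p)(x,p)·u ≤ −𝔖(x,p) + V(x,p)ᵀu; (b) S(x,p) = 0 if and only if V(x,p) = 0; and (c) 𝔖(x,p) = 0 if and only if V(x,p) = 0. -/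
open scoped BigOperators
open Finset

noncomputable section

namespace RMPC

lemma psi_nonpos {φ : ℝ → ℝ} (h : SignPreserving φ) {s : ℝ} (hs : s ≤ 0) : psiF φ s = 0 := by
  unfold psiF
  rw [intervalIntegral.integral_congr (g := fun _ => (0:ℝ))]
  · simp
  · intro r hr
    rw [Set.uIcc_of_ge hs] at hr
    exact h.2 r hr.2

lemma psi_pos {φ : ℝ → ℝ} (h : SignPreserving φ) (hc : Continuous φ) {s : ℝ} (hs : 0 < s) :
    0 < psiF φ s := by
  unfold psiF
  exact intervalIntegral.intervalIntegral_pos_of_pos_on (hc.intervalIntegrable _ _)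
    (fun r hr => h.1 r hr.1) hs

lemma psi_nonneg {φ : ℝ → ℝ} (h : SignPreserving φ) (hc : Continuous φ) (s : ℝ) :
    0 ≤ psiF φ s := by
  rcases le_or_gt s 0 with hs | hs
  · exact (psi_nonpos h hs).ge
  · exact (psi_pos h hc hs).le

lemma phi_nonneg {φ : ℝ → ℝ} (h : SignPreserving φ) (s : ℝ) : 0 ≤ φ s := by
  rcases le_or_gt s 0 with hs | hs
  · exact (h.2 s hs).ge
  · exact (h.1 s hs).le

lemma psi_deriv {φ : ℝ → ℝ} (hc : Continuous φ) (s : ℝ) : HasDerivAt (psiF φ) (φ s) s :=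
  (hc.integral_hasStrictDerivAt 0 s).hasDerivAt

lemma gamma_nonneg {n : ℕ} {φ : Fin n → ℝ → ℝ} (hφ : ∀ j, SignPreserving (φ j))
    (hc : ∀ j, Continuous (φ j)) (i : Fin n) (p : Fin n → ℝ) : 0 ≤ gammaF n φ i p :=
  Finset.sum_nonneg fun k _ => psi_nonneg (hφ k) (hc k) _

lemma gamma_pos {n : ℕ} {φ : Fin n → ℝ → ℝ} (hφ : ∀ j, SignPreserving (φ j))
    (hc : ∀ j, Continuous (φ j)) {i k : Fin n} {p : Fin n → ℝ} (h : p i < p k) :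
    0 < gammaF n φ i p :=
  Finset.sum_pos' (fun k _ => psi_nonneg (hφ k) (hc k) _)
    ⟨k, Finset.mem_univ _, psi_pos (hφ k) (hc k) (sub_pos.2 h)⟩

lemma gamma_max {n : ℕ} {φ : Fin n → ℝ → ℝ} (hφ : ∀ j, SignPreserving (φ j))
    {i : Fin n} {p : Fin n → ℝ} (h : ∀ k, p k ≤ p i) :
    gammaF n φ i p = 0 :=
  Finset.sum_eq_zero fun k _ => psi_nonpos (hφ k) (sub_nonpos.2 (h k))

lemma gamma_fderiv {n : ℕ} {φ : Fin n → ℝ → ℝ} (hc : ∀ j, Continuous (φ j)) (i : Fin n)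
    (p : Fin n → ℝ) :
    HasFDerivAt (gammaF n φ i)
      (∑ k, (φ k (p k - p i)) • ((ContinuousLinearMap.proj k : (Fin n → ℝ) →L[ℝ] ℝ)
        - ContinuousLinearMap.proj i)) p := by
  unfold gammaF
  apply HasFDerivAt.fun_sum
  intro k _
  exact (psi_deriv (hc k) (p k - p i)).comp_hasFDerivAt p
    (f := fun p : Fin n → ℝ => p k - p i)
    ((hasFDerivAt_apply k p).sub (hasFDerivAt_apply i p))

lemma V_eq {n : ℕ} (lam : Fin n → ℝ) (τ : ℝ) (φ : Fin n → ℝ → ℝ)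
    (hφ : ∀ j, SignPreserving (φ j)) (x p : Fin n → ℝ) (i : Fin n) :
    Vdyn n lam τ φ x p i = (1 / τ) * ∑ j, (lam j * x j * φ i (p i - p j)
      - lam i * x i * φ j (p j - p i)) := by
  have h0 : φ i (p i - p i) = 0 := (hφ i).2 _ (by simp)
  unfold Vdyn
  rw [Finset.sum_erase _ (by rw [h0]; ring), Finset.sum_erase _ (by rw [h0]; ring),
    ← Finset.sum_sub_distrib, Finset.mul_sum]
  exact Finset.sum_congr rfl fun j _ => by ring

lemma V_sum {n : ℕ} (lam : Fin n → ℝ) (τ : ℝ) (φ : Fin n → ℝ → ℝ)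
    (hφ : ∀ j, SignPreserving (φ j)) (x p f : Fin n → ℝ) :
    ∑ i, Vdyn n lam τ φ x p i * f i =
      (1 / τ) * ∑ j, lam j * x j * ∑ i, φ i (p i - p j) * (f i - f j) := by
  simp only [V_eq lam τ φ hφ, Finset.mul_sum, sub_mul, mul_sub, Finset.sum_mul,
    Finset.sum_sub_distrib]
  congr 1
  · rw [Finset.sum_comm]
    exact Finset.sum_congr rfl fun j _ => Finset.sum_congr rfl fun i _ => by ring
  · exact Finset.sum_congr rfl fun j _ => Finset.sum_congr rfl fun i _ => by ring

lemma A_pos {n : ℕ} (lam : Fin n → ℝ) (hlam : ∀ i, 0 < lam i)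
    (φ : Fin n → ℝ → ℝ)
    (hφ : ∀ j, SignPreserving (φ j))
    (hc : ∀ j, Continuous (φ j))
    (hcond : n = 2 ∨ (3 ≤ n ∧ lamR n lam < lamBar n φ)) (p : Fin n → ℝ) (j m : Fin n)
    (hm : p j < p m) :
    0 < ∑ i, φ i (p i - p j) * (lam j * gammaF n φ j p - lam i * gammaF n φ i p) := by
  have hg := gamma_pos hφ hc hm
  have hsum : 0 < ∑ i, φ i (p i - p j) :=
    Finset.sum_pos' (fun i _ => phi_nonneg (hφ i) _)
      ⟨m, Finset.mem_univ _, (hφ m).1 _ (sub_pos.2 hm)⟩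
  have hnn : ∀ (k : Fin n) (q : Fin n → ℝ) (i : Fin n),
      0 ≤ φ i (q i - q k) * gammaF n φ i q :=
    fun k q i => mul_nonneg (phi_nonneg (hφ i) _) (gamma_nonneg hφ hc i q)
  have hD : 0 ≤ ∑ i, φ i (p i - p j) * gammaF n φ i p :=
    Finset.sum_nonneg fun i _ => hnn j p i
  have key : lamR n lam * ∑ i, φ i (p i - p j) * gammaF n φ i p
      < gammaF n φ j p * ∑ i, φ i (p i - p j) := by
    rcases hD.eq_or_lt with h | h
    · rw [← h, mul_zero]; positivity
    · rcases hcond with h2 | ⟨_, h3⟩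
      · exfalso
        apply h.ne'
        apply Finset.sum_eq_zero
        intro i _
        rcases le_or_gt (p i) (p j) with hij | hij
        · rw [(hφ i).2 _ (sub_nonpos.2 hij), zero_mul]
        · rw [gamma_max hφ, mul_zero]
          intro k
          have hne : i ≠ j := by rintro rfl; exact lt_irrefl _ hij
          have : k = i ∨ k = j := by
            subst h2
            omega
          rcases this with rfl | rfl
          · exact le_rfl
          · exact hij.le
      · rw [← lt_div_iff₀ h]
        refine h3.trans_le ((ciInf_le (Set.finite_range _).bddBelow j).trans
          (csInf_le ⟨0, ?_⟩ ⟨p, h.ne', rfl⟩))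
        rintro c ⟨q, _, rfl⟩
        exact div_nonneg (mul_nonneg (gamma_nonneg hφ hc _ _)
          (Finset.sum_nonneg fun i _ => phi_nonneg (hφ i) _))
          (Finset.sum_nonneg fun i _ => hnn j q i)
  have hr : ∀ i, lam i ≤ lam j * lamR n lam := by
    intro i
    rw [mul_comm, ← div_le_iff₀ (hlam j)]
    exact le_ciSup (f := fun ij : Fin n × Fin n => lam ij.1 / lam ij.2)
      (Set.finite_range _).bddAbove (i, j)
  calc 0 < lam j * (gammaF n φ j p * ∑ i, φ i (p i - p j)
        - lamR n lam * ∑ i, φ i (p i - p j) * gammaF n φ i p) :=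
        mul_pos (hlam j) (sub_pos.2 key)
    _ = ∑ i, (lam j * gammaF n φ j p * φ i (p i - p j)
        - (lam j * lamR n lam) * (φ i (p i - p j) * gammaF n φ i p)) := by
        rw [Finset.sum_sub_distrib, ← Finset.mul_sum, ← Finset.mul_sum]; ring
    _ ≤ _ := by
        apply Finset.sum_le_sum
        intro i _
        have := mul_le_mul_of_nonneg_right (hr i) (hnn j p i)
        linarith

lemma S_fderiv_x {n : ℕ} (lam : Fin n → ℝ) (τ : ℝ) (φ : Fin n → ℝ → ℝ) (x p : Fin n → ℝ) :
    HasFDerivAt (fun y => Sfun n lam τ φ y p)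
      ((1 / τ) • ∑ i, (lam i * gammaF n φ i p) •
        (ContinuousLinearMap.proj i : (Fin n → ℝ) →L[ℝ] ℝ)) x := by
  have : (fun y => Sfun n lam τ φ y p) = ⇑((1 / τ) • ∑ i, (lam i * gammaF n φ i p) •
        (ContinuousLinearMap.proj i : (Fin n → ℝ) →L[ℝ] ℝ)) := by
    funext y
    simp only [Sfun, ContinuousLinearMap.smul_apply, ContinuousLinearMap.sum_apply,
      ContinuousLinearMap.proj_apply, smul_eq_mul]
    congr 1
    exact Finset.sum_congr rfl fun i _ => by ring
  rw [this]
  exact ContinuousLinearMap.hasFDerivAt _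

lemma S_fderiv_p {n : ℕ} (lam : Fin n → ℝ) (τ : ℝ) (φ : Fin n → ℝ → ℝ)
    (hc : ∀ j, Continuous (φ j)) (x p : Fin n → ℝ) :
    HasFDerivAt (fun q => Sfun n lam τ φ x q)
      ((1 / τ) • ∑ i, (lam i * x i) • ∑ k, (φ k (p k - p i)) •
        ((ContinuousLinearMap.proj k : (Fin n → ℝ) →L[ℝ] ℝ)
        - ContinuousLinearMap.proj i)) p := by
  unfold Sfun
  apply HasFDerivAt.const_mul
  apply HasFDerivAt.fun_sum
  intro i _
  exact (gamma_fderiv hc i p).const_mul _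

/-- **δ-passivity of RM-PC protocols** (Theorem 1). If `n = 2`, or `n ≥ 3` and
`λ_R < λ̄_φ(n)`, then there exist nonnegative `S` (differentiable in each argument)
and `𝔖` satisfying the δ-passivity inequality and the zero-level characterizations. -/
theorem rmpc_delta_passive (n : ℕ) (hn : 2 ≤ n)
    (lam : Fin n → ℝ) (hlam : ∀ i, 0 < lam i)
    (τ : ℝ) (hτ : 0 < τ)
    (φ : Fin n → ℝ → ℝ)
    (hφ : ∀ j, SignPreserving (φ j))
    (hLip : ∀ j, ∃ K, LipschitzWith K (φ j))
    (hcond : n = 2 ∨ (3 ≤ n ∧ lamR n lam < lamBar n φ)) :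
    ∃ S 𝔖 : (Fin n → ℝ) → (Fin n → ℝ) → ℝ,
      (∀ x ∈ simplex n, ∀ p : Fin n → ℝ, 0 ≤ S x p ∧ 0 ≤ 𝔖 x p) ∧
      (∀ x ∈ simplex n, ∀ p : Fin n → ℝ,
        DifferentiableAt ℝ (fun y => S y p) x ∧
        DifferentiableAt ℝ (fun q => S x q) p) ∧
      (∀ x ∈ simplex n, ∀ p u : Fin n → ℝ,
        fderiv ℝ (fun y => S y p) x (fun i => Vdyn n lam τ φ x p i)
            + fderiv ℝ (fun q => S x q) p u
          ≤ -𝔖 x p + ∑ i, Vdyn n lam τ φ x p i * u i) ∧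
      (∀ x ∈ simplex n, ∀ p : Fin n → ℝ,
        (S x p = 0 ↔ ∀ i, Vdyn n lam τ φ x p i = 0)) ∧
      (∀ x ∈ simplex n, ∀ p : Fin n → ℝ,
        (𝔖 x p = 0 ↔ ∀ i, Vdyn n lam τ φ x p i = 0)) := by
  have hc : ∀ j, Continuous (φ j) := fun j => (hLip j).choose_spec.continuous
  have hτ' : 0 < 1 / τ := by positivity
  have hA := A_pos lam hlam φ hφ hc hcond
  have hA0 : ∀ (p : Fin n → ℝ) (j : Fin n), (∀ k, p k ≤ p j) →
      ∑ i, φ i (p i - p j) * (lam j * gammaF n φ j p - lam i * gammaF n φ i p) = 0 :=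
    fun p j h => Finset.sum_eq_zero fun i _ => by
      rw [(hφ i).2 _ (sub_nonpos.2 (h i)), zero_mul]
  have hAn : ∀ (p : Fin n → ℝ) (j : Fin n),
      0 ≤ ∑ i, φ i (p i - p j) * (lam j * gammaF n φ j p - lam i * gammaF n φ i p) := by
    intro p j
    by_cases h : ∀ k, p k ≤ p j
    · exact (hA0 p j h).ge
    · push Not at h
      obtain ⟨m, hm⟩ := h
      exact (hA p j m hm).le
  have hSig : ∀ x p, SigFun n lam τ φ x p = (1 / τ) * ((1 / τ) * ∑ j, lam j * x j *
      ∑ i, φ i (p i - p j) * (lam j * gammaF n φ j p - lam i * gammaF n φ i p)) := by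
    intro x p
    have h := V_sum lam τ φ hφ x p (fun i => lam i * gammaF n φ i p)
    have h1 : ∑ i, lam i * Vdyn n lam τ φ x p i * gammaF n φ i p
        = ∑ i, Vdyn n lam τ φ x p i * (lam i * gammaF n φ i p) :=
      Finset.sum_congr rfl fun i _ => by ring
    unfold SigFun
    rw [h1, h, ← mul_neg, ← mul_neg, ← Finset.sum_neg_distrib]
    congr 2
    refine Finset.sum_congr rfl fun j _ => ?_
    rw [← mul_neg, ← Finset.sum_neg_distrib]
    congr 1
    exact Finset.sum_congr rfl fun i _ => by ring
  have hSQ : ∀ x ∈ simplex n, ∀ p : Fin n → ℝ,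
      (Sfun n lam τ φ x p = 0 ↔ ∀ j, x j = 0 ∨ ∀ k, p k ≤ p j) := by
    intro x hx p
    unfold Sfun
    rw [mul_eq_zero_iff_left hτ'.ne', Finset.sum_eq_zero_iff_of_nonneg
      (fun i _ => mul_nonneg (mul_nonneg (hlam i).le (hx.1 i)) (gamma_nonneg hφ hc i p))]
    refine ⟨fun h j => ?_, fun h j _ => ?_⟩
    · by_contra! hcon
      obtain ⟨h1, m, hm⟩ := hcon
      exact mul_ne_zero (mul_ne_zero (hlam j).ne' h1) (gamma_pos hφ hc hm).ne'
        (h j (Finset.mem_univ _))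
    · rcases h j with h | h
      · rw [h]; ring
      · rw [gamma_max hφ h]; ring
  have hGQ : ∀ x ∈ simplex n, ∀ p : Fin n → ℝ,
      (SigFun n lam τ φ x p = 0 ↔ ∀ j, x j = 0 ∨ ∀ k, p k ≤ p j) := by
    intro x hx p
    rw [hSig, mul_eq_zero_iff_left hτ'.ne', mul_eq_zero_iff_left hτ'.ne',
      Finset.sum_eq_zero_iff_of_nonneg
      (fun i _ => mul_nonneg (mul_nonneg (hlam i).le (hx.1 i)) (hAn p i))]
    refine ⟨fun h j => ?_, fun h j _ => ?_⟩
    · by_contra! hcon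
      obtain ⟨h1, m, hm⟩ := hcon
      exact mul_ne_zero (mul_ne_zero (hlam j).ne' h1) (hA p j m hm).ne'
        (h j (Finset.mem_univ _))
    · rcases h j with h | h
      · rw [h]; ring
      · rw [hA0 p j h]; ring
  have hVQ : ∀ x ∈ simplex n, ∀ p : Fin n → ℝ,
      ((∀ j, x j = 0 ∨ ∀ k, p k ≤ p j) ↔ ∀ i, Vdyn n lam τ φ x p i = 0) := by
    intro x hx p
    constructor
    · intro h i
      have h' : ∀ j i, x j * φ i (p i - p j) = 0 := by
        intro j i
        rcases h j with h | h
        · rw [h, zero_mul]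
        · rw [(hφ i).2 _ (sub_nonpos.2 (h i)), mul_zero]
      rw [V_eq lam τ φ hφ, Finset.sum_eq_zero, mul_zero]
      intro j _
      rw [mul_assoc, mul_assoc, h', h']; ring
    · intro h
      rw [← hGQ x hx p]
      simp [SigFun, h]
  refine ⟨Sfun n lam τ φ, SigFun n lam τ φ, ?_, ?_, ?_,
    fun x hx p => (hSQ x hx p).trans (hVQ x hx p),
    fun x hx p => (hGQ x hx p).trans (hVQ x hx p)⟩
  · intro x hx p
    refine ⟨mul_nonneg hτ'.le (Finset.sum_nonneg fun i _ =>
      mul_nonneg (mul_nonneg (hlam i).le (hx.1 i)) (gamma_nonneg hφ hc i p)), ?_⟩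
    rw [hSig]
    exact mul_nonneg hτ'.le (mul_nonneg hτ'.le (Finset.sum_nonneg fun i _ =>
      mul_nonneg (mul_nonneg (hlam i).le (hx.1 i)) (hAn p i)))
  · intro x hx p
    exact ⟨(S_fderiv_x lam τ φ x p).differentiableAt,
      (S_fderiv_p lam τ φ hc x p).differentiableAt⟩
  · intro x hx p u
    rw [(S_fderiv_x lam τ φ x p).fderiv, (S_fderiv_p lam τ φ hc x p).fderiv,
      V_sum lam τ φ hφ x p u]
    unfold SigFun
    simp only [ContinuousLinearMap.smul_apply, ContinuousLinearMap.sum_apply,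
      ContinuousLinearMap.sub_apply, ContinuousLinearMap.proj_apply, smul_eq_mul, neg_neg]
    apply le_of_eq
    congr 2
    exact Finset.sum_congr rfl fun i _ => by ring

end RMPC
end
end

section
/- Fix an integer n ≥ 3 and suppose the sign-preserving Lipschitz functions φ_1,…,φ_n of an RM-PC protocol all coincide with a single non-decreasing function φ̄ : ℝ → ℝ_{≥0} (i.e., φ_i(s) = φ̄(s) for all s ∈ ℝ and all i). Then the threshold λ̄_φ(n) satisfies λ̄_φ(n) ≥ (n − 1)/(n − 2). -/
open scoped BigOperators
open Finset

noncomputable section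

namespace RMPC

theorem psi_zero {f : ℝ → ℝ} (hsp : SignPreserving f) {s : ℝ} (hs : s ≤ 0) :
    psiF f s = 0 := by
  unfold psiF
  apply intervalIntegral.integral_zero_ae
  refine Filter.Eventually.of_forall (fun r hr => ?_)
  rw [Set.uIoc_of_ge hs] at hr
  exact hsp.2 r hr.2

theorem sp_nonneg {f : ℝ → ℝ} (hsp : SignPreserving f) (s : ℝ) : 0 ≤ f s := by
  rcases le_or_gt s 0 with h | h
  · exact (hsp.2 s h).ge
  · exact (hsp.1 s h).le

theorem psi_mono {f : ℝ → ℝ} (hsp : SignPreserving f) (hm : Monotone f) :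
    Monotone (psiF f) := by
  intro a b hab
  have h := intervalIntegral.integral_add_adjacent_intervals
    (hm.intervalIntegrable (μ := MeasureTheory.volume) (a := 0) (b := a))
    (hm.intervalIntegrable (μ := MeasureTheory.volume) (a := a) (b := b))
  have h2 : 0 ≤ ∫ r in a..b, f r :=
    intervalIntegral.integral_nonneg hab (fun r _ => sp_nonneg hsp r)
  unfold psiF
  linarith

theorem psi_nonneg_s2 {f : ℝ → ℝ} (hsp : SignPreserving f) (hm : Monotone f) (s : ℝ) :
    0 ≤ psiF f s := by
  rcases le_or_gt s 0 with h | h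
  · exact (psi_zero hsp h).ge
  · rw [← psi_zero hsp (le_refl 0)]
    exact psi_mono hsp hm h.le

theorem psi_pos_s2 {f : ℝ → ℝ} (hsp : SignPreserving f) (hm : Monotone f) {s : ℝ} (hs : 0 < s) :
    0 < psiF f s :=
  intervalIntegral.intervalIntegral_pos_of_pos_on hm.intervalIntegrable
    (fun x hx => hsp.1 x hx.1) hs

theorem key (n : ℕ) (hn : 3 ≤ n) {f : ℝ → ℝ} (hsp : SignPreserving f) (hm : Monotone f)
    (k : Fin n) (p : Fin n → ℝ) :
    ((n : ℝ) - 1) * (∑ i, f (p i - p k) * ∑ j, psiF f (p j - p i)) ≤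
      ((n : ℝ) - 2) * ((∑ j, psiF f (p j - p k)) * ∑ i, f (p i - p k)) := by
  have hn' : (3 : ℝ) ≤ n := by exact_mod_cast hn
  have hD : (∑ i, f (p i - p k) * ∑ j, psiF f (p j - p i)) ≤
      ((n : ℝ) - 2) * ∑ j, f (p j - p k) * psiF f (p j - p k) := by
    simp_rw [Finset.mul_sum]
    rw [Finset.sum_comm]
    refine Finset.sum_le_sum (fun j _ => ?_)
    by_cases hjk : j = k
    · subst hjk
      have : f (p j - p j) = 0 := hsp.2 _ (by simp)
      rw [this]
      simp only [zero_mul, mul_zero]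
      refine Finset.sum_nonpos (fun i _ => ?_)
      rcases le_or_gt (p i - p j) 0 with h | h
      · simp [hsp.2 _ h]
      · rw [psi_zero hsp (by linarith : p j - p i ≤ 0)]; simp
    · have hsub : ∑ i ∈ (Finset.univ.erase k).erase j, f (p i - p k) * psiF f (p j - p i)
          = ∑ i, f (p i - p k) * psiF f (p j - p i) := by
        apply Finset.sum_subset (Finset.subset_univ _)
        intro i _ hi
        simp only [Finset.mem_erase, Finset.mem_univ, and_true, not_and_or, not_not] at hi
        rcases hi with rfl | rfl
        · rw [psi_zero hsp (by simp)]; simp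
        · rw [hsp.2 _ (by simp)]; simp
      rw [← hsub]
      have hc : ((((Finset.univ.erase k).erase j).card : ℕ) : ℝ) = (n : ℝ) - 2 := by
        rw [Finset.card_erase_of_mem (by simp [hjk]), Finset.card_erase_of_mem (by simp)]
        simp only [Finset.card_univ, Fintype.card_fin]
        rw [Nat.sub_sub, Nat.cast_sub (by omega)]
        norm_num
      rw [← hc, ← nsmul_eq_mul]
      refine Finset.sum_le_card_nsmul _ _ _ (fun i _ => ?_)
      have hR : 0 ≤ f (p j - p k) * psiF f (p j - p k) :=
        mul_nonneg (sp_nonneg hsp _) (psi_nonneg_s2 hsp hm _)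
      rcases le_or_gt (p i - p k) 0 with h | h
      · rw [hsp.2 _ h]; simpa using hR
      · rcases le_or_gt (p j - p i) 0 with h' | h'
        · rw [psi_zero hsp h']; simpa using hR
        · exact mul_le_mul (hm (by linarith)) (psi_mono hsp hm (by linarith))
            (psi_nonneg_s2 hsp hm _) (sp_nonneg hsp _)
  have hN : (∑ i, f (p i - p k) * ∑ j, psiF f (p j - p i)) +
      (∑ j, f (p j - p k) * psiF f (p j - p k)) ≤
      (∑ j, psiF f (p j - p k)) * ∑ i, f (p i - p k) := by
    rw [← Finset.sum_add_distrib, mul_comm, Finset.sum_mul]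
    refine Finset.sum_le_sum (fun i _ => ?_)
    rw [← mul_add]
    rcases le_or_gt (p i - p k) 0 with h | h
    · simp [hsp.2 _ h]
    · refine mul_le_mul_of_nonneg_left ?_ (sp_nonneg hsp _)
      rw [← Finset.add_sum_erase _ _ (Finset.mem_univ i),
        ← Finset.add_sum_erase (a := i) _ (fun j => psiF f (p j - p k)) (Finset.mem_univ i),
        psi_zero hsp (by simp : p i - p i ≤ 0)]
      have : ∑ x ∈ Finset.univ.erase i, psiF f (p x - p i) ≤
          ∑ x ∈ Finset.univ.erase i, psiF f (p x - p k) :=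
        Finset.sum_le_sum (fun x _ => psi_mono hsp hm (by linarith))
      linarith
  nlinarith [mul_le_mul_of_nonneg_left hN (by linarith : (0:ℝ) ≤ (n:ℝ) - 2)]

theorem D_nonneg (n : ℕ) {f : ℝ → ℝ} (hsp : SignPreserving f) (hm : Monotone f)
    (k : Fin n) (p : Fin n → ℝ) :
    0 ≤ ∑ i, f (p i - p k) * ∑ j, psiF f (p j - p i) :=
  Finset.sum_nonneg (fun _ _ => mul_nonneg (sp_nonneg hsp _)
    (Finset.sum_nonneg (fun _ _ => psi_nonneg_s2 hsp hm _)))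

theorem D_pos (n : ℕ) (hn : 3 ≤ n) {f : ℝ → ℝ} (hsp : SignPreserving f) (hm : Monotone f)
    (k : Fin n) : ∃ p : Fin n → ℝ,
    0 < ∑ i, f (p i - p k) * ∑ j, psiF f (p j - p i) := by
  obtain ⟨i, hi⟩ : ∃ i, i ∉ ({k} : Finset (Fin n)) := by
    by_contra! h
    have := Finset.card_le_card (fun x _ => h x : (Finset.univ : Finset (Fin n)) ⊆ {k})
    simp at this
    omega
  obtain ⟨j, hj⟩ : ∃ j, j ∉ ({k, i} : Finset (Fin n)) := by
    by_contra! h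
    have := Finset.card_le_card (fun x _ => h x : (Finset.univ : Finset (Fin n)) ⊆ {k, i})
    have h2 := Finset.card_le_two (a := k) (b := i)
    simp only [Finset.card_univ, Fintype.card_fin] at this
    omega
  simp only [Finset.mem_singleton, Finset.mem_insert, not_or] at hi hj
  refine ⟨fun l => if l = k then 0 else if l = i then 1 else 2, ?_⟩
  refine Finset.sum_pos' (fun _ _ => mul_nonneg (sp_nonneg hsp _)
    (Finset.sum_nonneg (fun _ _ => psi_nonneg_s2 hsp hm _))) ⟨i, Finset.mem_univ _, ?_⟩
  refine mul_pos (hsp.1 _ (by simp [hi])) ?_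
  refine Finset.sum_pos' (fun _ _ => psi_nonneg_s2 hsp hm _) ⟨j, Finset.mem_univ _, ?_⟩
  exact psi_pos_s2 hsp hm (by simp [hi, hj.1, hj.2])

/-- **Proposition 1.** If all `φ_i` coincide with a common non-decreasing `φ̄`,
then `λ̄_φ(n) ≥ (n−1)/(n−2)` for `n ≥ 3`. -/
theorem lamBar_lower_bound (n : ℕ) (hn : 3 ≤ n)
    (φbar : ℝ → ℝ) (hsp : SignPreserving φbar)
    (hLip : ∃ K, LipschitzWith K φbar)
    (hmono : Monotone φbar)
    (φ : Fin n → ℝ → ℝ) (hφ : ∀ i, φ i = φbar) :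
    ((n : ℝ) - 1) / ((n : ℝ) - 2) ≤ lamBar n φ := by
  have hn' : (3 : ℝ) ≤ n := by exact_mod_cast hn
  obtain rfl : φ = fun _ => φbar := funext hφ
  haveI : Nonempty (Fin n) := ⟨⟨0, by omega⟩⟩
  unfold lamBar
  refine le_ciInf (fun k => le_csInf ?_ ?_)
  · obtain ⟨p, hp⟩ := D_pos n hn hsp hmono k
    exact ⟨_, p, hp.ne', rfl⟩
  · rintro c ⟨p, hp, rfl⟩
    have h0 := D_nonneg n hsp hmono k p
    have hk := key n hn hsp hmono k p
    simp only [gammaF] at hp ⊢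
    have hpos := lt_of_le_of_ne h0 hp.symm
    rw [div_le_div_iff₀ (by linarith) hpos]
    linarith

end RMPC
end
end

section
/- Let n = 3 and consider the RM-PC protocol specified by φ_1(s) = (max(s,0))², φ_2(s) = φ_3(s) = max(s,0). Then the threshold satisfies λ̄_φ(3) ≤ 1; in particular, the lower bound λ̄_φ(n) ≥ (n−1)/(n−2) of the proposition fails for this protocol, which violates the assumption that all φ_i coincide with a common non-decreasing function. -/
open scoped BigOperators
open Finset

noncomputable section

namespace RMPC

/-- The RM-PC protocol of the counterexample: `φ_1(s) = (max(s,0))²`,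
`φ_2(s) = φ_3(s) = max(s,0)`. -/
def phiCounter : Fin 3 → ℝ → ℝ :=
  ![fun s => (max s 0) ^ 2, fun s => max s 0, fun s => max s 0]

theorem psi_sq (s : ℝ) : psiF (fun s => (max s 0) ^ 2) s = (max s 0) ^ 3 / 3 := by
  unfold psiF
  rcases le_total 0 s with h | h
  · rw [intervalIntegral.integral_congr (g := fun r => r ^ 2)]
    · rw [integral_pow, max_eq_left h]; norm_num
    · intro r hr
      rw [Set.uIcc_of_le h] at hr
      simp only [max_eq_left hr.1]
  · rw [intervalIntegral.integral_congr (g := fun _ => (0 : ℝ))]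
    · simp [max_eq_right h]
    · intro r hr
      rw [Set.uIcc_of_ge h] at hr
      simp [max_eq_right hr.2]

theorem psi_lin (s : ℝ) : psiF (fun s => max s 0) s = (max s 0) ^ 2 / 2 := by
  unfold psiF
  rcases le_total 0 s with h | h
  · rw [intervalIntegral.integral_congr (g := fun r => r)]
    · rw [integral_id, max_eq_left h]; norm_num
    · intro r hr
      rw [Set.uIcc_of_le h] at hr
      simp only [max_eq_left hr.1]
  · rw [intervalIntegral.integral_congr (g := fun _ => (0 : ℝ))]
    · simp [max_eq_right h]
    · intro r hr
      rw [Set.uIcc_of_ge h] at hr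
      simp [max_eq_right hr.2]

theorem gamma_eq (i : Fin 3) (p : Fin 3 → ℝ) : gammaF 3 phiCounter i p =
    (max (p 0 - p i) 0) ^ 3 / 3 + (max (p 1 - p i) 0) ^ 2 / 2 + (max (p 2 - p i) 0) ^ 2 / 2 := by
  simp only [gammaF, Fin.sum_univ_three]
  rw [← psi_sq, ← psi_lin, ← psi_lin]
  rfl

theorem gamma_nonneg_s3 (i : Fin 3) (p : Fin 3 → ℝ) : 0 ≤ gammaF 3 phiCounter i p := by
  rw [gamma_eq]
  have := le_max_right (p 0 - p i) 0
  positivity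

theorem phi_nonneg_s3 (i : Fin 3) (s : ℝ) : 0 ≤ phiCounter i s := by
  fin_cases i
  · exact sq_nonneg _
  · exact le_max_right _ _
  · exact le_max_right _ _

theorem bdd (k : Fin 3) : BddBelow (thresholdSet 3 phiCounter k) := by
  refine ⟨0, ?_⟩
  rintro c ⟨p, -, rfl⟩
  exact div_nonneg (mul_nonneg (gamma_nonneg_s3 _ _) (Finset.sum_nonneg fun i _ => phi_nonneg_s3 _ _))
    (Finset.sum_nonneg fun i _ => mul_nonneg (phi_nonneg_s3 _ _) (gamma_nonneg_s3 _ _))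

theorem mem_set (t : ℝ) (ht : 1 < t) :
    (1 + 2 * t⁻¹ ^ 2 / 3) * (1 + t⁻¹) / (1 - t⁻¹ ^ 3) ^ 2 ∈ thresholdSet 3 phiCounter 1 := by
  have t0 : 0 < t := by linarith
  have t3 : 1 < t ^ 3 := one_lt_pow₀ ht (by norm_num)
  have h4 : 0 < t ^ 4 := by positivity
  have h7 : 0 < t ^ 7 := by positivity
  have hd : 0 < t ^ 7 - t ^ 4 := by nlinarith
  have g0 : gammaF 3 phiCounter 0 ![t ^ 4, 0, t ^ 7] = (t ^ 7 - t ^ 4) ^ 2 / 2 := by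
    rw [gamma_eq]; simp [max_eq_left hd.le, h4.le]
  have g1 : gammaF 3 phiCounter 1 ![t ^ 4, 0, t ^ 7] = (t ^ 4) ^ 3 / 3 + (t ^ 7) ^ 2 / 2 := by
    rw [gamma_eq]; simp [max_eq_left h4.le, max_eq_left h7.le]
  have g2 : gammaF 3 phiCounter 2 ![t ^ 4, 0, t ^ 7] = 0 := by
    rw [gamma_eq]; simp [max_eq_right (show t ^ 4 - t ^ 7 ≤ 0 by linarith), h7.le]
  have f0 : phiCounter 0 (t ^ 4) = (t ^ 4) ^ 2 := by
    simp [phiCounter, h4.le]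
  have f1 : phiCounter 1 0 = 0 := by simp [phiCounter]
  have f2 : phiCounter 2 (t ^ 7) = t ^ 7 := by
    simp [phiCounter, h7.le]
  have hD : ∑ i, phiCounter i ((![t ^ 4, 0, t ^ 7] : Fin 3 → ℝ) i - (![t ^ 4, 0, t ^ 7] : Fin 3 → ℝ) 1)
      * gammaF 3 phiCounter i ![t ^ 4, 0, t ^ 7] = (t ^ 4) ^ 2 * ((t ^ 7 - t ^ 4) ^ 2 / 2) := by
    rw [Fin.sum_univ_three, g0, g1, g2]
    simp [f0, f1]
  have hN : ∑ i, phiCounter i ((![t ^ 4, 0, t ^ 7] : Fin 3 → ℝ) i - (![t ^ 4, 0, t ^ 7] : Fin 3 → ℝ) 1)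
      = (t ^ 4) ^ 2 + t ^ 7 := by
    rw [Fin.sum_univ_three]
    simp [f0, f1, f2]
  refine ⟨![t ^ 4, 0, t ^ 7], ?_, ?_⟩
  · rw [hD]; positivity
  · rw [hD, hN, g1]
    have e : 1 - t⁻¹ ^ 3 = (t ^ 7 - t ^ 4) / t ^ 7 := by field_simp
    rw [e]
    have := hd.ne'
    rw [div_eq_div_iff (by positivity) (by positivity)]
    field_simp
    ring

theorem le_one : lamBar 3 phiCounter ≤ 1 := by
  refine (ciInf_le (Set.finite_range _).bddBelow 1).trans ?_
  have hc : Filter.Tendsto (fun u : ℝ => (1 + 2 * u ^ 2 / 3) * (1 + u) / (1 - u ^ 3) ^ 2)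
      (nhds 0) (nhds 1) := by
    have : ContinuousAt (fun u : ℝ => (1 + 2 * u ^ 2 / 3) * (1 + u) / (1 - u ^ 3) ^ 2) 0 := by
      apply ContinuousAt.div (by fun_prop) (by fun_prop)
      norm_num
    simpa [ContinuousAt] using this
  refine ge_of_tendsto (hc.comp tendsto_inv_atTop_zero) ?_
  filter_upwards [Filter.eventually_gt_atTop 1] with t ht
  exact csInf_le (bdd 1) (mem_set t ht)

/-- **Counterexample.** For the above protocol `λ̄_φ(3) ≤ 1`; in particular the
lower bound `(n−1)/(n−2)` of Proposition 1 fails. -/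
theorem lamBar_counterexample :
    lamBar 3 phiCounter ≤ 1 ∧
    lamBar 3 phiCounter < ((3 : ℝ) - 1) / ((3 : ℝ) - 2) := by
  have h := le_one
  exact ⟨h, by norm_num; linarith⟩

end RMPC
end
end

section
/- Fix an integer n ≥ 2, positive revision rates λ_1,…,λ_n, a positive normalization constant τ̄, and sign-preserving Lipschitz functions φ_1,…,φ_n defining an RM-PC protocol. For every fixed x in the simplex X, the storage function p ↦ S(x,p) is differentiable and its gradient with respect to p equals the mean dynamics vector: (∂S/∂p)(x,p)·u = V(x,p)ᵀu for all p, u ∈ ℝ^n. -/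
open scoped BigOperators
open Finset

noncomputable section

namespace RMPC

/-- For fixed `x` in the simplex, `p ↦ S(x,p)` is differentiable and its
gradient with respect to `p` is the mean-dynamics vector `V(x,p)`. -/
theorem storage_gradient_eq_dynamics (n : ℕ) (hn : 2 ≤ n)
    (lam : Fin n → ℝ) (hlam : ∀ i, 0 < lam i)
    (τ : ℝ) (hτ : 0 < τ)
    (φ : Fin n → ℝ → ℝ)
    (hφ : ∀ j, SignPreserving (φ j))
    (hLip : ∀ j, ∃ K, LipschitzWith K (φ j)) :
    ∀ x ∈ simplex n, ∀ p : Fin n → ℝ,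
      ∃ L : (Fin n → ℝ) →L[ℝ] ℝ,
        HasFDerivAt (fun q => Sfun n lam τ φ x q) L p ∧
        ∀ u : Fin n → ℝ, L u = ∑ i, Vdyn n lam τ φ x p i * u i := by
  intro x _ p
  have hψ : ∀ k (s : ℝ), HasDerivAt (psiF (φ k)) (φ k s) s := by
    intro k s
    obtain ⟨K, hK⟩ := hLip k
    exact (hK.continuous.integral_hasStrictDerivAt 0 s).hasDerivAt
  have hpr : ∀ k : Fin n, HasFDerivAt (fun q : Fin n → ℝ => q k)
      (ContinuousLinearMap.proj (R := ℝ) (φ := fun _ : Fin n => ℝ) k) p := fun k =>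
    (ContinuousLinearMap.proj (R := ℝ) (φ := fun _ : Fin n => ℝ) k).hasFDerivAt
  have hg : ∀ i, HasFDerivAt (fun q => gammaF n φ i q)
      (∑ k, φ k (p k - p i) • (ContinuousLinearMap.proj (R := ℝ) (φ := fun _ : Fin n => ℝ) k
        - ContinuousLinearMap.proj (R := ℝ) (φ := fun _ : Fin n => ℝ) i)) p := by
    intro i
    unfold gammaF
    exact HasFDerivAt.fun_sum fun k _ =>
      HasDerivAt.comp_hasFDerivAt (h₂ := psiF (φ k)) (f := fun q : Fin n → ℝ => q k - q i) p
        (hψ k (p k - p i)) ((hpr k).fun_sub (hpr i))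
  have hS := (HasFDerivAt.fun_sum (u := Finset.univ)
    fun i _ => (hg i).const_mul (lam i * x i)).const_mul (1 / τ)
  refine ⟨_, hS, fun u => ?_⟩
  have hV : ∀ i, Vdyn n lam τ φ x p i = (∑ j, lam j * (1 / τ) * φ i (p i - p j) * x j)
      - ∑ j, lam i * (1 / τ) * φ j (p j - p i) * x i := by
    intro i
    unfold Vdyn
    rw [Finset.sum_erase, Finset.sum_erase] <;> simp [(hφ i).2 0 le_rfl]
  simp only [hV, sub_mul, Finset.sum_sub_distrib, Finset.sum_mul]
  rw [Finset.sum_comm, ← Finset.sum_sub_distrib]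
  simp only [← Finset.sum_sub_distrib, ContinuousLinearMap.smul_apply,
    ContinuousLinearMap.sum_apply, ContinuousLinearMap.sub_apply,
    ContinuousLinearMap.proj_apply, smul_eq_mul, Finset.mul_sum]
  refine Finset.sum_congr rfl fun i _ => Finset.sum_congr rfl fun k _ => ?_
  ring

end RMPC
end
end

section
/- Let n = 2. Fix positive revision rates λ_1, λ_2, a positive normalization constant τ̄, and sign-preserving Lipschitz functions φ_1, φ_2 defining an RM-PC protocol. Then for all x in the simplex X and all p ∈ ℝ², 𝔖(x,p) = 0 if and only if V(x,p) = 0, where 𝔖(x,p) = −(1/τ̄) Σ_{i=1}^2 λ_i V_i(x,p) γ_i(p). -/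
open scoped BigOperators
open Finset

noncomputable section

namespace RMPC

theorem psiF_nonpos {f : ℝ → ℝ} (hf : SignPreserving f) {s : ℝ} (hs : s ≤ 0) : psiF f s = 0 := by
  unfold psiF
  rw [intervalIntegral.integral_congr (g := fun _ => (0:ℝ))]
  · simp
  · intro r hr
    rw [Set.uIcc_of_ge hs] at hr
    exact hf.2 r hr.2

theorem psiF_pos {f : ℝ → ℝ} (hf : SignPreserving f) (hc : Continuous f) {s : ℝ} (hs : 0 < s) :
    0 < psiF f s := by
  unfold psiF
  exact intervalIntegral.intervalIntegral_pos_of_pos_on (hc.intervalIntegrable _ _)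
    (fun r hr => hf.1 r hr.1) hs

/-- **Two-strategy case: `𝔖(x,p) = 0` iff `V(x,p) = 0`.** -/
theorem sigma_zero_iff_dynamics_zero_two_strategies
    (lam : Fin 2 → ℝ) (hlam : ∀ i, 0 < lam i)
    (τ : ℝ) (hτ : 0 < τ)
    (φ : Fin 2 → ℝ → ℝ)
    (hφ : ∀ j, SignPreserving (φ j))
    (hLip : ∀ j, ∃ K, LipschitzWith K (φ j)) :
    ∀ x ∈ simplex 2, ∀ p : Fin 2 → ℝ,
      (SigFun 2 lam τ φ x p = 0 ↔ ∀ i, Vdyn 2 lam τ φ x p i = 0) := by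
  intro x _ p
  have e0 : (Finset.univ.erase (0 : Fin 2)) = {1} := by decide
  have e1 : (Finset.univ.erase (1 : Fin 2)) = {0} := by decide
  have hV : Vdyn 2 lam τ φ x p 1 = - Vdyn 2 lam τ φ x p 0 := by
    simp only [Vdyn, e0, e1, Finset.sum_singleton]
    ring
  have hS : SigFun 2 lam τ φ x p = (1 / τ) * (Vdyn 2 lam τ φ x p 0 *
      (lam 1 * gammaF 2 φ 1 p - lam 0 * gammaF 2 φ 0 p)) := by
    simp only [SigFun, Fin.sum_univ_two, hV]
    ring
  have hc : ∀ j, Continuous (φ j) := fun j => (hLip j).elim fun _ h => h.continuous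
  have g0 : gammaF 2 φ 0 p = psiF (φ 1) (p 1 - p 0) := by
    simp [gammaF, Fin.sum_univ_two, psiF]
  have g1 : gammaF 2 φ 1 p = psiF (φ 0) (p 0 - p 1) := by
    simp [gammaF, Fin.sum_univ_two, psiF]
  constructor
  · intro h
    have hV0 : Vdyn 2 lam τ φ x p 0 = 0 := by
      rw [hS] at h
      rcases lt_trichotomy (p 0) (p 1) with hp | hp | hp
      · have a := psiF_pos (hφ 1) (hc 1) (sub_pos.2 hp)
        have b := psiF_nonpos (hφ 0) (sub_nonpos.2 hp.le)
        rw [g0, g1, b] at h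
        have := mul_pos (hlam 0) a
        rcases mul_eq_zero.1 h with h | h
        · exact absurd h (one_div_pos.2 hτ).ne'
        · rcases mul_eq_zero.1 h with h | h
          · exact h
          · linarith
      · simp only [Vdyn, e0, Finset.sum_singleton]
        rw [(hφ 0).2 _ (sub_nonpos.2 hp.le), (hφ 1).2 _ (sub_nonpos.2 hp.ge)]
        ring
      · have a := psiF_pos (hφ 0) (hc 0) (sub_pos.2 hp)
        have b := psiF_nonpos (hφ 1) (sub_nonpos.2 hp.le)
        rw [g0, g1, b] at h
        have := mul_pos (hlam 1) a
        rcases mul_eq_zero.1 h with h | h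
        · exact absurd h (one_div_pos.2 hτ).ne'
        · rcases mul_eq_zero.1 h with h | h
          · exact h
          · linarith
    intro i
    fin_cases i
    · exact hV0
    · simpa [hV0] using hV
  · intro h
    rw [hS, h 0]
    ring

end RMPC
end
end

section
/- Fix an integer n ≥ 3 and a non-decreasing, Lipschitz, sign-preserving function φ̄ : ℝ → ℝ_{≥0}. Then for every p ∈ ℝ^n with p_1 ≥ p_2 ≥ ⋯ ≥ p_n and Σ_{i=1}^n φ̄(p_i − p_n) γ̄_i(p) ≠ 0, one has Σ_{i=1}^n φ̄(p_i − p_n) γ̄_i(p) ≤ ((n−2)/(n−1)) · γ̄_n(p) · Σ_{i=1}^{n−1} φ̄(p_i − p_n). -/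
open scoped BigOperators
open Finset

noncomputable section

namespace RMPC

/-- **Step (iii) of the proof of Proposition 1.** For ordered payoff vectors with
nonvanishing denominator,
`Σ_i φ̄(p_i − p_n) γ̄_i(p) ≤ ((n−2)/(n−1)) γ̄_n(p) Σ_{i=1}^{n−1} φ̄(p_i − p_n)`. -/
theorem ordered_denominator_bound (n : ℕ) (hn : 3 ≤ n)
    (φbar : ℝ → ℝ) (hsp : SignPreserving φbar)
    (hLip : ∃ K, LipschitzWith K φbar)
    (hmono : Monotone φbar) :
    ∀ p : Fin n → ℝ, Antitone p →
      (∑ i, φbar (p i - p (⟨n - 1, by omega⟩ : Fin n)) *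
          gammaF n (fun _ => φbar) i p) ≠ 0 →
      (∑ i, φbar (p i - p (⟨n - 1, by omega⟩ : Fin n)) *
          gammaF n (fun _ => φbar) i p)
        ≤ (((n : ℝ) - 2) / ((n : ℝ) - 1)) *
            gammaF n (fun _ => φbar) (⟨n - 1, by omega⟩ : Fin n) p *
            ∑ i ∈ Finset.univ.erase (⟨n - 1, by omega⟩ : Fin n),
              φbar (p i - p (⟨n - 1, by omega⟩ : Fin n)) := by
  intro p hp _
  obtain ⟨K, hK⟩ := hLip
  have hint : ∀ a b : ℝ, IntervalIntegrable φbar MeasureTheory.volume a b :=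
    fun a b => hK.continuous.intervalIntegrable a b
  have hnn : ∀ s, 0 ≤ φbar s := fun s => by
    rcases le_or_gt s 0 with h | h
    · exact (hsp.2 s h).ge
    · exact (hsp.1 s h).le
  have hψ : Monotone (psiF φbar) := by
    intro a b hab
    have h1 := intervalIntegral.integral_add_adjacent_intervals (hint 0 a) (hint a b)
    have h2 : 0 ≤ ∫ r in a..b, φbar r := intervalIntegral.integral_nonneg hab fun u _ => hnn u
    unfold psiF
    linarith
  have hψ0 : ∀ s ≤ 0, psiF φbar s = 0 := by
    intro s hs
    unfold psiF
    rw [intervalIntegral.integral_congr (g := fun _ => (0 : ℝ))]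
    · simp
    · intro x hx
      rw [Set.uIcc_of_ge hs] at hx
      exact hsp.2 x hx.2
  have hψnn : ∀ s, 0 ≤ psiF φbar s := by
    intro s
    rcases le_or_gt s 0 with h | h
    · exact (hψ0 s h).ge
    · have := hψ h.le
      rwa [hψ0 0 le_rfl] at this
  generalize hL : (⟨n - 1, by omega⟩ : Fin n) = L
  obtain ⟨Z, hZ⟩ : ∃ Z : Fin n, Z = ⟨0, by omega⟩ := ⟨_, rfl⟩
  have hZL : Z ≠ L := by
    rw [hZ, ← hL, Ne, Fin.mk.injEq]
    omega
  have hpZ : ∀ i, p i ≤ p Z := fun i => hp (by rw [hZ, Fin.le_def]; exact Nat.zero_le _)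
  have hpL : ∀ i, p L ≤ p i := fun i => hp (by
    rw [← hL, Fin.le_def]; have := i.2; show i.1 ≤ n - 1; omega)
  have hgZ : gammaF n (fun _ => φbar) Z p = 0 :=
    Finset.sum_eq_zero fun k _ => hψ0 _ (by linarith [hpZ k])
  have hgL : ∀ i, gammaF n (fun _ => φbar) i p ≤ gammaF n (fun _ => φbar) L p :=
    fun i => Finset.sum_le_sum fun k _ => hψ (by linarith [hpL i])
  have hG : 0 ≤ gammaF n (fun _ => φbar) L p := Finset.sum_nonneg fun k _ => hψnn _
  generalize gammaF n (fun _ => φbar) L p = G at *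
  have haL : φbar (p L - p L) = 0 := hsp.2 _ (by simp)
  have haZ : ∀ i, φbar (p i - p L) ≤ φbar (p Z - p L) := fun i => hmono (by linarith [hpZ i])
  have hZmem : Z ∈ Finset.univ.erase L := by simp [hZL]
  have hcard : ((Finset.univ.erase L).card : ℝ) = (n : ℝ) - 1 := by
    rw [Finset.card_erase_of_mem (Finset.mem_univ _), Finset.card_univ, Fintype.card_fin,
      Nat.cast_sub (by omega)]
    simp
  have hS : ∑ i ∈ Finset.univ.erase L, φbar (p i - p L) ≤ ((n : ℝ) - 1) * φbar (p Z - p L) := by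
    have := Finset.sum_le_card_nsmul (Finset.univ.erase L) (fun i => φbar (p i - p L)) _
      (fun i _ => haZ i)
    rwa [nsmul_eq_mul, hcard] at this
  rw [← Finset.add_sum_erase _ _ (Finset.mem_univ L), haL, zero_mul, zero_add,
    ← Finset.add_sum_erase _ _ hZmem, hgZ, mul_zero, zero_add]
  have h1 : ∑ i ∈ (Finset.univ.erase L).erase Z,
      φbar (p i - p L) * gammaF n (fun _ => φbar) i p
      ≤ (∑ i ∈ (Finset.univ.erase L).erase Z, φbar (p i - p L)) * G := by
    rw [Finset.sum_mul]
    exact Finset.sum_le_sum fun i _ => mul_le_mul_of_nonneg_left (hgL i) (hnn _)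
  have h2 := Finset.add_sum_erase _ (fun i => φbar (p i - p L)) hZmem
  generalize ∑ i ∈ Finset.univ.erase L, φbar (p i - p L) = S at *
  have hn' : (0 : ℝ) < (n : ℝ) - 1 := by
    have : (3 : ℝ) ≤ n := by exact_mod_cast hn
    linarith
  have h3 : S / ((n : ℝ) - 1) ≤ φbar (p Z - p L) := by
    rw [div_le_iff₀ hn']; linarith
  have h4 : ((n : ℝ) - 2) / ((n : ℝ) - 1) * G * S = (S - S / ((n : ℝ) - 1)) * G := by
    field_simp
    ring
  rw [h4]
  refine h1.trans (mul_le_mul_of_nonneg_right ?_ hG)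
  linarith

end RMPC
end
end

section
/- Consider the hassle-vs-price game with ρ populations and κ strategies: for population r and strategy i, F_i^r(x) = −β^r λ_i^r − C_i(D_i(x)), where D_i(x) = Σ_{r=1}^ρ α^r x_i^r, the β^r and α^r are positive constants, the λ_i^r are positive constants, and each C_i : ℝ_{≥0} → ℝ is continuously differentiable and increasing. Then F is weighted contractive with weights w^r = α^r: for all x, x̃ in the product simplex 𝕏 = X^1 × ⋯ × X^ρ, Σ_{r=1}^ρ α^r (F^r(x) − F^r(x̃))ᵀ(x^r − x̃^r) ≤ 0. -/
open scoped BigOperators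
open Finset

noncomputable section

namespace RMPC

/-- **The hassle-vs-price game is weighted contractive with weights `w^r = α^r`.**
Payoffs: `F_i^r(x) = −β^r λ_i^r − C_i(D_i(x))` with `D_i(x) = Σ_r α^r x_i^r`. -/
theorem hpg_weighted_contractive (ρ κ : ℕ) (hρ : 1 ≤ ρ) (hκ : 1 ≤ κ)
    (α β : Fin ρ → ℝ) (hα : ∀ r, 0 < α r) (hβ : ∀ r, 0 < β r)
    (lam : Fin ρ → Fin κ → ℝ) (hlam : ∀ r i, 0 < lam r i)
    (C : Fin κ → ℝ → ℝ)
    (hC1 : ∀ i, ContDiff ℝ 1 (C i))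
    (hCmono : ∀ i, StrictMonoOn (C i) (Set.Ici 0)) :
    ∀ x y : Fin ρ → Fin κ → ℝ,
      (∀ r, x r ∈ simplex κ) → (∀ r, y r ∈ simplex κ) →
      (∑ r, α r * ∑ i,
        ((-(β r * lam r i) - C i (∑ s, α s * x s i))
            - (-(β r * lam r i) - C i (∑ s, α s * y s i)))
          * (x r i - y r i)) ≤ 0 := by
  intro x y hx hy
  have key : (∑ r, α r * ∑ i,
        ((-(β r * lam r i) - C i (∑ s, α s * x s i))
            - (-(β r * lam r i) - C i (∑ s, α s * y s i)))
          * (x r i - y r i))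
      = ∑ i, -((C i (∑ s, α s * x s i) - C i (∑ s, α s * y s i))
          * ((∑ s, α s * x s i) - ∑ s, α s * y s i)) := by
    simp_rw [Finset.mul_sum]
    rw [Finset.sum_comm]
    refine Finset.sum_congr rfl fun i _ => ?_
    rw [← Finset.sum_sub_distrib, Finset.mul_sum, ← Finset.sum_neg_distrib]
    refine Finset.sum_congr rfl fun r _ => ?_
    ring
  rw [key]
  refine Finset.sum_nonpos fun i _ => ?_
  have h1 : (0:ℝ) ≤ ∑ s, α s * x s i :=
    Finset.sum_nonneg fun s _ => mul_nonneg (hα s).le ((hx s).1 i)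
  have h2 : (0:ℝ) ≤ ∑ s, α s * y s i :=
    Finset.sum_nonneg fun s _ => mul_nonneg (hα s).le ((hy s).1 i)
  have hm := (hCmono i).monotoneOn
  rcases le_total (∑ s, α s * x s i) (∑ s, α s * y s i) with h | h
  · have := hm h1 h2 h
    nlinarith [mul_nonneg (sub_nonneg.2 this) (sub_nonneg.2 h)]
  · have := hm h2 h1 h
    nlinarith [mul_nonneg (sub_nonneg.2 this) (sub_nonneg.2 h)]

end RMPC
end
end
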